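/- Suppose a ranking τ of size k satisfies in-group monotonicity and prefix quotas m[i], and its selection utility is achieved by a pair (i, j) with i ∈ τ non-protected of minimal quality among non-protected elements of τ, and j ∉ τ protected with q_j > q_i. Then swapping i out for j (inserting j in its quality-sorted position among protected elements) yields a ranking that still satisfies in-group monotonicity and the prefix quotas, and has strictly larger selection utility. Hence at an optimum of selection utility, any utility-realizing excluded element is non-protected. -/

import Mathlib

/-- Selection utility of the ranking τ:
`min_{x ∉ τ} min(0, q̄ - q x)` with `q̄ = min_{t} q (τ t)`, expressed as an
infimum over the excluded candidates. -/
noncomputable def selUtility {n k : ℕ} (q : Fin n → ℝ) (τ : Fin k → Fin n) : ℝ :=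
  sInf {v : ℝ | ∃ x : Fin n, (∀ t : Fin k, τ t ≠ x) ∧
    v = min 0 (sInf (Set.range fun t : Fin k => q (τ t)) - q x)}

/-- Prefix quotas: the length-ℓ prefix contains at least m ℓ protected
elements, for every ℓ ≤ k. -/
def prefQuota {n k : ℕ} (g : Fin n → Bool) (m : ℕ → ℕ) (τ : Fin k → Fin n) : Prop :=
  ∀ ℓ : ℕ, ℓ ≤ k →
    m ℓ ≤ (Finset.univ.filter fun t : Fin k => (t : ℕ) < ℓ ∧ g (τ t) = true).card

theorem sort_aux {k : ℕ} (p : Fin k → Prop) [DecidablePred p] (f : Fin k → ℝ) :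
    ∃ σ : Equiv.Perm (Fin k), (∀ t, ¬ p t → σ t = t) ∧ (∀ t, p t → p (σ t)) ∧
      ∀ a b, p a → p b → a < b → f (σ b) ≤ f (σ a) := by
  let e : Fin (Fintype.card {t // p t}) ≃o {t // p t} := Fintype.orderIsoFinOfCardEq _ rfl
  let π := Tuple.sort (fun x => - f (e x).1)
  have hπ := Tuple.monotone_sort (fun x => - f (e x).1)
  let s : Equiv.Perm {t // p t} := (e.symm.toEquiv.trans π).trans e.toEquiv
  have hs : ∀ t (h : p t), Equiv.Perm.ofSubtype s t = (e (π (e.symm ⟨t, h⟩))).1 := by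
    intro t h
    rw [Equiv.Perm.ofSubtype_apply_of_mem s h]
    rfl
  refine ⟨Equiv.Perm.ofSubtype s, ?_, ?_, ?_⟩
  · intro t ht
    exact Equiv.Perm.ofSubtype_apply_of_not_mem s ht
  · intro t ht
    rw [hs t ht]
    exact (e (π (e.symm ⟨t, ht⟩))).2
  · intro a b ha hb hab
    rw [hs a ha, hs b hb]
    have h1 : e.symm ⟨a, ha⟩ ≤ e.symm ⟨b, hb⟩ := e.symm.monotone (by exact hab.le)
    have h2 := hπ h1
    simp only [Function.comp] at h2
    exact neg_le_neg_iff.mp h2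

/-- if τ satisfies in-group monotonicity and the prefix quotas,
and its selection utility is realized by the pair (i, j) where i ∈ τ is
non-protected of minimal quality in τ (in particular minimal among the
non-protected members) and j ∉ τ is protected with q j > q i, then swapping i
out for j yields a ranking ρ that still satisfies in-group monotonicity and the
prefix quotas and has strictly larger selection utility. -/
theorem stmt15 {n k : ℕ} (q : Fin n → ℝ) (hq : Function.Injective q)
    (g : Fin n → Bool) (m : ℕ → ℕ)
    (hm0 : m 0 = 0) (hmono : Monotone m) (hstep : ∀ l, m (l + 1) ≤ m l + 1)
    (τ : Fin k → Fin n) (hinj : Function.Injective τ)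
    (hgm : ∀ a b : Fin k, g (τ a) = g (τ b) → a < b → q (τ b) ≤ q (τ a))
    (hquota : prefQuota g m τ)
    (i j : Fin n) (ti : Fin k) (hti : τ ti = i) (hgi : g i = false)
    (hminnp : ∀ t : Fin k, g (τ t) = false → q i ≤ q (τ t))
    (hminall : ∀ t : Fin k, q i ≤ q (τ t))
    (hj : ∀ t : Fin k, τ t ≠ j) (hgj : g j = true) (hij : q i < q j)
    (hach : selUtility q τ = min 0 (q i - q j)) :
    ∃ ρ : Fin k → Fin n, Function.Injective ρ ∧
      (∀ a b : Fin k, g (ρ a) = g (ρ b) → a < b → q (ρ b) ≤ q (ρ a)) ∧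
      prefQuota g m ρ ∧
      Set.range ρ = (Set.range τ \ {i}) ∪ {j} ∧
      selUtility q τ < selUtility q ρ := by
  classical
  have hkey : ∀ t, τ t = i ↔ t = ti := fun t =>
    ⟨fun h => hinj (h.trans hti.symm), fun h => h ▸ hti⟩
  let r : Fin k → Fin n := fun t => if t = ti then j else τ t
  have rti : r ti = j := by simp [r]
  have rne : ∀ t, t ≠ ti → r t = τ t := fun t h => by simp [r, h]
  have rinj : Function.Injective r := by
    intro a b hab
    by_cases ha : a = ti <;> by_cases hb : b = ti
    · rw [ha, hb]
    · rw [ha, rti, rne b hb] at hab; exact absurd hab.symm (hj b)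
    · rw [hb, rti, rne a ha] at hab; exact absurd hab (hj a)
    · rw [rne a ha, rne b hb] at hab; exact hinj hab
  have rrange : Set.range r = (Set.range τ \ {i}) ∪ {j} := by
    ext x
    constructor
    · rintro ⟨t, rfl⟩
      by_cases h : t = ti
      · right; rw [h, rti]; rfl
      · left; rw [rne t h]; exact ⟨⟨t, rfl⟩, fun h' => h ((hkey t).1 h')⟩
    · rintro (⟨⟨t, rfl⟩, h⟩ | h)
      · exact ⟨t, rne t (fun h' => h ((hkey t).2 h'))⟩
      · exact ⟨ti, rti.trans (Set.mem_singleton_iff.1 h).symm⟩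
  obtain ⟨σ, h1, h2, h3⟩ := sort_aux (fun t => g (r t) = true) (fun t => q (r t))
  have hρg : ∀ t, g (r (σ t)) = g (r t) := by
    intro t
    by_cases h : g (r t) = true
    · rw [h]; exact h2 t h
    · rw [h1 t h]
  have hρrange : Set.range (fun t => r (σ t)) = (Set.range τ \ {i}) ∪ {j} := by
    rw [← rrange]; exact σ.surjective.range_comp r
  refine ⟨fun t => r (σ t), rinj.comp σ.injective, ?_, ?_, hρrange, ?_⟩
  · intro a b hab hlt
    simp only [hρg] at hab
    by_cases h : g (r a) = true
    · exact h3 a b h (hab ▸ h) hlt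
    · have hb : ¬ g (r b) = true := hab ▸ h
      have ha' : a ≠ ti := by rintro rfl; exact h (rti ▸ hgj)
      have hb' : b ≠ ti := by rintro rfl; exact hb (rti ▸ hgj)
      simp only [h1 a h, h1 b hb]
      rw [rne a ha', rne b hb'] at *
      exact hgm a b hab hlt
  · intro l hl
    refine (hquota l hl).trans (Finset.card_le_card ?_)
    intro t
    simp only [Finset.mem_filter, Finset.mem_univ, true_and, hρg]
    rintro ⟨ht, hg⟩
    refine ⟨ht, ?_⟩
    have : t ≠ ti := by rintro rfl; rw [hti, hgi] at hg; exact absurd hg (by decide)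
    rw [rne t this]; exact hg
  · have hfin : ∀ (ρ : Fin k → Fin n), {v : ℝ | ∃ x : Fin n, (∀ t : Fin k, ρ t ≠ x) ∧
        v = min 0 (sInf (Set.range fun t : Fin k => q (ρ t)) - q x)}.Finite := by
      intro ρ
      refine (Set.finite_range (fun x : Fin n =>
        min 0 (sInf (Set.range fun t : Fin k => q (ρ t)) - q x))).subset ?_
      rintro v ⟨x, -, rfl⟩
      exact ⟨x, rfl⟩
    have hbar : sInf (Set.range fun t : Fin k => q (τ t)) = q i := by
      apply IsLeast.csInf_eq
      refine ⟨⟨ti, by simp [hti]⟩, ?_⟩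
      rintro _ ⟨t, rfl⟩
      exact hminall t
    have hmax : ∀ x, (∀ t, τ t ≠ x) → q x ≤ q j := by
      intro x hx
      have : selUtility q τ ≤ min 0 (q i - q x) :=
        csInf_le (hfin τ).bddBelow ⟨x, hx, by rw [hbar]⟩
      rw [hach, min_eq_right (by linarith)] at this
      have := this.trans (min_le_right _ _)
      linarith
    have hρi : ∀ t, r (σ t) ≠ i := by
      intro t h
      have : i ∈ (Set.range τ \ {i}) ∪ {j} := hρrange ▸ ⟨t, h⟩
      rcases this with h | h
      · exact h.2 rfl
      · exact hij.ne (congrArg q h)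
    have hbar' : q i < sInf (Set.range fun t : Fin k => q (r (σ t))) := by
      have hm : sInf (Set.range fun t : Fin k => q (r (σ t))) ∈
          Set.range fun t : Fin k => q (r (σ t)) :=
        Set.Nonempty.csInf_mem ⟨_, ⟨ti, rfl⟩⟩ (Set.finite_range _)
      obtain ⟨t, ht⟩ := hm
      rw [← ht]
      have hmem : r (σ t) ∈ (Set.range τ \ {i}) ∪ {j} := hρrange ▸ ⟨t, rfl⟩
      rcases hmem with ⟨⟨s, hs⟩, h⟩ | h
      · exact lt_of_le_of_ne ((hminall s).trans_eq (congrArg q hs)) (fun h' => hρi t (hq h').symm)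
      · have h' : r (σ t) = j := h
        simp only [h']; exact hij
    have hm : selUtility q (fun t => r (σ t)) ∈ _ :=
      Set.Nonempty.csInf_mem ⟨_, ⟨i, hρi, rfl⟩⟩ (hfin (fun t => r (σ t)))
    obtain ⟨x, hx, hv⟩ := hm
    rw [hv, hach, min_eq_right (by linarith : q i - q j ≤ 0)]
    refine lt_min (by linarith) ?_
    have hxj : q x ≤ q j := by
      by_cases hxi : x = i
      · rw [hxi]; exact hij.le
      · apply hmax
        intro t ht
        have : x ∈ Set.range (fun t => r (σ t)) := by
          rw [hρrange]; exact Or.inl ⟨⟨t, ht⟩, hxi⟩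
        obtain ⟨s, hs⟩ := this
        exact hx s hs
    linarith
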